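/- arXiv:2406.06989 — 4 statements merged into one kernel-verified Lean document; each statement's English description precedes it below -/
import Mathlib

section
/- Let H be a complex Hilbert space, A a bounded everywhere-defined self-adjoint operator on H, and P a densely defined self-adjoint operator on H, and suppose the operator PA (domain {x : Ax ∈ D(P)}, x ↦ P(Ax)) is densely defined. If the operator AP (domain D(P), x ↦ A(Px)) is closed, then the operator APA (domain D(PA), x ↦ A(P(Ax))) is self-adjoint. -/
/-- The composition `P ∘ A` of a partially defined operator `P` with an everywhere-defined
bounded operator `A`, with domain `{x : A x ∈ D(P)}`, acting as `x ↦ P (A x)`. -/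
noncomputable def LinearPMap.compCLM {H : Type*} [NormedAddCommGroup H]
    [InnerProductSpace ℂ H] (P : H →ₗ.[ℂ] H) (A : H →L[ℂ] H) : H →ₗ.[ℂ] H where
  domain := P.domain.comap (A : H →ₗ[ℂ] H)
  toFun := P.toFun.comp (((A : H →ₗ[ℂ] H)).restrict fun _ hx => hx)

/-- The composition `A ∘ P` of an everywhere-defined bounded operator `A` with a partially
defined operator `P`, with domain `D(P)`, acting as `x ↦ A (P x)`. -/
noncomputable def ContinuousLinearMap.compPMap {H : Type*} [NormedAddCommGroup H]
    [InnerProductSpace ℂ H] (A : H →L[ℂ] H) (P : H →ₗ.[ℂ] H) : H →ₗ.[ℂ] H where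
  domain := P.domain
  toFun := ((A : H →ₗ[ℂ] H)).comp P.toFun

/-- For self-adjoint `P`: a weak solution lies in the domain. -/
lemma aux_selfadjoint_mem {H : Type*} [NormedAddCommGroup H]
    [InnerProductSpace ℂ H] [CompleteSpace H]
    (P : H →ₗ.[ℂ] H) (hPsa : IsSelfAdjoint P) (y w : H)
    (h : ∀ x : P.domain, inner ℂ w (x : H) = inner ℂ y (P x)) :
    ∃ hy : y ∈ P.domain, P ⟨y, hy⟩ = w := by
  have hd := hPsa.dense_domain
  have hm : y ∈ P.adjoint.domain := LinearPMap.mem_adjoint_domain_of_exists y ⟨w, h⟩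
  have he : P.adjoint ⟨y, hm⟩ = w := LinearPMap.adjoint_apply_eq hd ⟨y, hm⟩ h
  have hg : (y, w) ∈ P.adjoint.graph := by
    rw [LinearPMap.mem_graph_iff]
    exact ⟨⟨y, hm⟩, rfl, he⟩
  rw [LinearPMap.isSelfAdjoint_def.mp hPsa, LinearPMap.mem_graph_iff] at hg
  obtain ⟨⟨z, hz⟩, h1, h2⟩ := hg
  dsimp at h1 h2
  subst h1
  exact ⟨hz, h2⟩

/-- `(PA)* ⊆ AP`. -/
lemma aux_adjoint_le {H : Type*} [NormedAddCommGroup H]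
    [InnerProductSpace ℂ H] [CompleteSpace H] (A : H →L[ℂ] H)
    (hA : ∀ x y : H, inner ℂ (A x) y = inner ℂ x (A y))
    (P : H →ₗ.[ℂ] H) (hPsa : IsSelfAdjoint P)
    (hAP : (A.compPMap P).IsClosed) (u w : H)
    (h : ∀ (x : H) (hx : A x ∈ P.domain), inner ℂ w x = inner ℂ u (P ⟨A x, hx⟩)) :
    ∃ hu : u ∈ P.domain, A (P ⟨u, hu⟩) = w := by
  let g : Submodule ℂ (WithLp 2 (H × H)) :=
    (A.compPMap P).graph.comap (WithLp.linearEquiv 2 ℂ (H × H)).toLinearMap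
  have hg : IsClosed (g : Set (WithLp 2 (H × H))) :=
    IsClosed.preimage (WithLp.prod_continuous_ofLp 2 H H) hAP
  have hc : gᗮᗮ = g := by
    rw [Submodule.orthogonal_orthogonal_eq_closure]
    exact hg.submodule_topologicalClosure_eq
  have hmem : WithLp.toLp 2 (u, w) ∈ g := by
    rw [← hc, Submodule.mem_orthogonal']
    intro v hv
    rw [Submodule.mem_orthogonal'] at hv
    obtain ⟨hb, hPb⟩ := aux_selfadjoint_mem P hPsa (A v.snd) (-v.fst) (by
      intro x
      have hx : WithLp.toLp 2 ((x : H), A (P x)) ∈ g := by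
        change ((x : H), A (P x)) ∈ (A.compPMap P).graph
        rw [LinearPMap.mem_graph_iff]
        exact ⟨x, rfl, rfl⟩
      have := hv _ hx
      rw [WithLp.prod_inner_apply] at this
      change inner ℂ v.fst (x : H) + inner ℂ v.snd (A (P x)) = 0 at this
      rw [inner_neg_left, hA]
      linear_combination -this)
    have h1 := h v.snd hb
    rw [hPb, inner_neg_right] at h1
    rw [WithLp.prod_inner_apply]
    change inner ℂ u v.fst + inner ℂ w v.snd = 0
    rw [h1]; ring
  have hmem' : (u, w) ∈ (A.compPMap P).graph := hmem
  rw [LinearPMap.mem_graph_iff] at hmem'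
  obtain ⟨⟨z, hz⟩, h1, h2⟩ := hmem'
  dsimp at h1
  subst h1
  exact ⟨hz, h2⟩

/-- if `PA` is densely defined and `AP` is closed, then `APA` is self-adjoint. -/
theorem isSelfAdjoint_of_isClosed_clm_comp_pmap {H : Type*} [NormedAddCommGroup H]
    [InnerProductSpace ℂ H] [CompleteSpace H] (A : H →L[ℂ] H) (hA : IsSelfAdjoint A)
    (P : H →ₗ.[ℂ] H) (hPdense : Dense (P.domain : Set H)) (hPsa : IsSelfAdjoint P)
    (hPA : Dense ((P.compCLM A).domain : Set H))
    (hAP : (A.compPMap P).IsClosed) :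
    IsSelfAdjoint (A.compPMap (P.compCLM A)) := by
  have hA' : ∀ x y : H, inner ℂ (A x) y = inner ℂ x (A y) := fun x y =>
    hA.isSymmetric x y
  have hd : Dense ((A.compPMap (P.compCLM A)).domain : Set H) := hPA
  have hPs : P.IsFormalAdjoint P := by
    have := LinearPMap.adjoint_isFormalAdjoint hPdense
    rwa [LinearPMap.isSelfAdjoint_def.mp hPsa] at this
  rw [LinearPMap.isSelfAdjoint_def]
  apply le_antisymm
  · have key : ∀ y : (A.compPMap (P.compCLM A)).adjoint.domain,
        ∃ hu : A (y : H) ∈ P.domain,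
          A (P ⟨A y, hu⟩) = (A.compPMap (P.compCLM A)).adjoint y := by
      intro y
      apply aux_adjoint_le A hA' P hPsa hAP
      intro x hx
      rw [LinearPMap.adjoint_isFormalAdjoint hd y ⟨x, hx⟩, hA']
      rfl
    refine ⟨fun y hy => (key ⟨y, hy⟩).1, ?_⟩
    rintro ⟨y, hy⟩ ⟨z, hz⟩ hyz
    dsimp at hyz
    subst hyz
    exact (key ⟨y, hy⟩).2.symm
  · apply LinearPMap.IsFormalAdjoint.le_adjoint hd
    intro x y
    change inner ℂ (A (P ⟨A x, x.2⟩)) (y : H) = inner ℂ (x : H) (A (P ⟨A y, y.2⟩))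
    rw [hA', ← hA' (x : H)]
    exact hPs ⟨A x, x.2⟩ ⟨A y, y.2⟩
end

section
/- Let H be a complex Hilbert space, A a bounded everywhere-defined self-adjoint operator on H, and P a densely defined self-adjoint operator on H, and suppose the operator PA (domain {x : Ax ∈ D(P)}, x ↦ P(Ax)) is densely defined. If A has an everywhere-defined bounded inverse, then the operator APA (domain D(PA), x ↦ A(P(Ax))) is self-adjoint. -/
/-- if `PA` is densely defined and `A` has an everywhere-defined bounded
inverse, then `APA` is self-adjoint. -/
theorem isSelfAdjoint_of_invertible {H : Type*} [NormedAddCommGroup H]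
    [InnerProductSpace ℂ H] [CompleteSpace H] (A : H →L[ℂ] H) (hA : IsSelfAdjoint A)
    (P : H →ₗ.[ℂ] H) (hPdense : Dense (P.domain : Set H)) (hPsa : IsSelfAdjoint P)
    (hPA : Dense ((P.compCLM A).domain : Set H))
    (B : H →L[ℂ] H) (hBA : ∀ x, B (A x) = x) (hAB : ∀ x, A (B x) = x) :
    IsSelfAdjoint (A.compPMap (P.compCLM A)) := by
  have hPeq : P.adjoint = P := hPsa
  have hsym : ∀ x y, inner ℂ (A x) y = inner ℂ x (A y) := fun x y => hA.isSymmetric x y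
  have hPf : P.IsFormalAdjoint P := by
    have h := LinearPMap.adjoint_isFormalAdjoint hPdense
    rwa [hPeq] at h
  have hTd : Dense ((A.compPMap (P.compCLM A)).domain : Set H) := hPA
  have hf : (A.compPMap (P.compCLM A)).IsFormalAdjoint (A.compPMap (P.compCLM A)) := by
    intro x y
    have h := hPf ⟨A x, x.2⟩ ⟨A y, y.2⟩
    change inner ℂ (A (P ⟨A x, x.2⟩)) (y : H) = inner ℂ (x : H) (A (P ⟨A y, y.2⟩))
    rw [hsym (P _), ← hsym (x : H)]
    exact h
  have hle := hf.le_adjoint hTd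
  rw [LinearPMap.isSelfAdjoint_def]
  refine (LinearPMap.eq_of_le_of_domain_eq hle (le_antisymm hle.1 ?_)).symm
  intro y hy
  have key : A y ∈ P.adjoint.domain := by
    apply LinearPMap.mem_adjoint_domain_of_exists
    refine ⟨B ((A.compPMap (P.compCLM A)).adjoint ⟨y, hy⟩), fun z => ?_⟩
    have hz : A (B z) ∈ P.domain := by rw [hAB]; exact z.2
    have h := LinearPMap.adjoint_isFormalAdjoint hTd ⟨y, hy⟩ ⟨B z, hz⟩
    change inner ℂ _ (B z) = inner ℂ y (A (P ⟨A (B z), hz⟩)) at h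
    have hz' : (⟨A (B z), hz⟩ : P.domain) = z := Subtype.ext (hAB z)
    rw [hz', ← hsym] at h
    rw [← h]
    conv_lhs => rw [← hAB (z : H), ← hsym, hAB]
  rw [hPeq] at key
  exact key
end

section
/- Let H be a complex Hilbert space, A a bounded everywhere-defined self-adjoint operator on H, and P a densely defined self-adjoint operator on H such that the operator PA (domain {x : Ax ∈ D(P)}, x ↦ P(Ax)) is densely defined. Suppose the range R(A) of A is closed, the kernel N(A) of A is contained in D(P), and P maps N(A) into N(A). Then the adjoint of PA equals the operator AP (domain D(P), x ↦ A(Px)): (PA)* = AP. -/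
/-- if `PA` is densely defined, the range of `A` is closed, the kernel of `A` is
contained in `D(P)`, and `P` maps the kernel of `A` into itself, then `(PA)* = AP`. -/
theorem adjoint_pmap_comp_clm_eq {H : Type*} [NormedAddCommGroup H]
    [InnerProductSpace ℂ H] [CompleteSpace H] (A : H →L[ℂ] H) (hA : IsSelfAdjoint A)
    (P : H →ₗ.[ℂ] H) (hPdense : Dense (P.domain : Set H)) (hPsa : IsSelfAdjoint P)
    (hPA : Dense ((P.compCLM A).domain : Set H))
    (hrange : IsClosed (Set.range A))
    (hker : ∀ x : H, A x = 0 → x ∈ P.domain)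
    (hPker : ∀ x : P.domain, A (x : H) = 0 → A (P x) = 0) :
    (P.compCLM A).adjoint = A.compPMap P := by
  have hsym : ∀ x y : H, inner ℂ (A x) y = inner ℂ x (A y) := fun x y => by
    rw [← ContinuousLinearMap.adjoint_inner_right, hA.adjoint_eq]
  have hPadj : P.adjoint = P := hPsa
  have hPsym : ∀ x y : P.domain, inner ℂ (P x) (y : H) = inner ℂ (x : H) (P y) := by
    have h := LinearPMap.adjoint_isFormalAdjoint hPdense
    rw [hPadj] at h
    exact fun x y => h x y
  have hdec : ∀ x : H, ∃ n ξ : H, A n = 0 ∧ x = n + A ξ := by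
    intro x
    let K : Submodule ℂ H := LinearMap.range (A : H →ₗ[ℂ] H)
    have hK : IsClosed (K : Set H) := by
      have : (K : Set H) = Set.range A := by ext; simp [K]
      rw [this]; exact hrange
    haveI : CompleteSpace K := hK.completeSpace_coe
    obtain ⟨k, hk, n, hn, hx⟩ := K.exists_add_mem_mem_orthogonal x
    obtain ⟨ξ, rfl⟩ := hk
    refine ⟨n, ξ, ?_, by rw [hx, add_comm]; rfl⟩
    have h1 := (Submodule.mem_orthogonal' K n).1 hn (A (A n)) ⟨A n, rfl⟩
    rw [← hsym] at h1
    exact inner_self_eq_zero.1 h1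
  have hval : ∀ (x : (P.compCLM A).domain), (P.compCLM A) x = P ⟨A x, x.2⟩ := fun _ => rfl
  have hle : A.compPMap P ≤ (P.compCLM A).adjoint := by
    apply LinearPMap.IsFormalAdjoint.le_adjoint hPA
    intro x y
    have h := hPsym ⟨A x, x.2⟩ y
    rw [hval, h]
    exact (hsym _ _)
  refine (LinearPMap.eq_of_le_of_domain_eq hle (le_antisymm hle.1 ?_)).symm
  intro y hy
  change y ∈ P.domain
  have hz : ∀ x : (P.compCLM A).domain,
      inner ℂ ((P.compCLM A).adjoint ⟨y, hy⟩) (x : H) = inner ℂ y ((P.compCLM A) x) :=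
    fun x => LinearPMap.adjoint_isFormalAdjoint hPA ⟨y, hy⟩ x
  generalize (P.compCLM A).adjoint ⟨y, hy⟩ = z at hz
  have hz' : ∀ (ξ : H) (h : A ξ ∈ P.domain), inner ℂ z ξ = inner ℂ y (P ⟨A ξ, h⟩) :=
    fun ξ h => hz ⟨ξ, h⟩
  have hzker : ∀ n, A n = 0 → inner ℂ z n = 0 := by
    intro n hn
    have h0 : A n ∈ P.domain := by rw [hn]; exact P.domain.zero_mem
    have h1 : (⟨A n, h0⟩ : P.domain) = 0 := Subtype.ext hn
    rw [hz' n h0, h1, LinearPMap.map_zero, inner_zero_right]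
  obtain ⟨n, v, hn, hzv⟩ := hdec z
  obtain ⟨m, η, hm, hv⟩ := hdec v
  have hn0 : n = 0 := by
    have h := hzker n hn
    rw [hzv, inner_add_left, hsym, hn, inner_zero_right, add_zero] at h
    exact inner_self_eq_zero.1 h
  have hzA : z = A (A η) := by
    rw [hzv, hn0, hv, map_add, hm, zero_add, zero_add]
  obtain ⟨y0, ζ, hy0, hyd⟩ := hdec y
  rw [← hPadj]
  apply LinearPMap.mem_adjoint_domain_of_exists
  refine ⟨P ⟨y0, hker y0 hy0⟩ + A η, fun u => ?_⟩
  obtain ⟨k, ξ, hk, hu⟩ := hdec u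
  have hξ : A ξ ∈ P.domain := by
    have : A ξ = (u : H) - k := by rw [hu]; abel
    rw [this]; exact P.domain.sub_mem u.2 (hker k hk)
  have hu' : u = (⟨k, hker k hk⟩ : P.domain) + ⟨A ξ, hξ⟩ := Subtype.ext hu
  have hPk := hPker ⟨k, hker k hk⟩ hk
  have hPy := hPker ⟨y0, hker y0 hy0⟩ hy0
  have e1 : inner ℂ y (P ⟨k, hker k hk⟩) = inner ℂ (P ⟨y0, hker y0 hy0⟩) k := by
    rw [hyd, inner_add_left, hsym, hPk, inner_zero_right, add_zero]
    exact (hPsym ⟨y0, hker y0 hy0⟩ ⟨k, hker k hk⟩).symm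
  have e2 : inner ℂ y (P ⟨A ξ, hξ⟩) = inner ℂ (A η) (A ξ) := by
    rw [← hz' ξ hξ, hzA, hsym]
  have e3 : inner ℂ (P ⟨y0, hker y0 hy0⟩) (A ξ) = 0 := by
    rw [← hsym, hPy, inner_zero_left]
  have e4 : inner ℂ (A η) k = 0 := by
    rw [hsym, hk, inner_zero_right]
  have e5 : P u = P ⟨k, hker k hk⟩ + P ⟨A ξ, hξ⟩ := by
    rw [← LinearPMap.map_add, ← hu']
  rw [e5, inner_add_right, e1, e2, hu, inner_add_left, inner_add_right, inner_add_right, e3, e4]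
  ring
end

section
/- Let H be a complex Hilbert space, A a bounded everywhere-defined self-adjoint operator on H, and P a densely defined self-adjoint operator on H. Suppose that D(PA) = D(P) (i.e., A maps D(P) into D(P)), and that there is a bounded everywhere-defined operator B on H with B(D(P)) ⊆ D(P) such that P(Af) − A(Pf) = Bf for every f ∈ D(P). Then the operator AP (domain D(P), x ↦ A(Px)) is closed, and consequently the operator APA (domain D(PA), x ↦ A(P(Ax))) is self-adjoint. -/
/-- if `D(PA) = D(P)` and the commutator `PA - AP` is (the restriction to `D(P)` of)
a bounded everywhere-defined operator `B` with `B D(P) ⊆ D(P)`, then `AP` is closed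
and consequently `APA` is self-adjoint. -/
theorem isClosed_and_isSelfAdjoint_of_bounded_commutator {H : Type*} [NormedAddCommGroup H]
    [InnerProductSpace ℂ H] [CompleteSpace H] (A : H →L[ℂ] H) (hA : IsSelfAdjoint A)
    (P : H →ₗ.[ℂ] H) (hPdense : Dense (P.domain : Set H)) (hPsa : IsSelfAdjoint P)
    (hdom : (P.compCLM A).domain = P.domain)
    (B : H →L[ℂ] H) (hBdom : ∀ x ∈ P.domain, B x ∈ P.domain)
    (hcomm : ∀ (f : P.domain) (hAf : A (f : H) ∈ P.domain),
      P ⟨A (f : H), hAf⟩ - A (P f) = B (f : H)) :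
    (A.compPMap P).IsClosed ∧ IsSelfAdjoint (A.compPMap (P.compCLM A)) := by
  have hmem : ∀ x : H, A x ∈ P.domain ↔ x ∈ P.domain := by
    intro x
    change x ∈ (P.compCLM A).domain ↔ x ∈ P.domain
    rw [hdom]
  have hadj : P.adjoint = P := hPsa
  have hsymP : ∀ x y : P.domain, inner ℂ (P x) (y : H) = inner ℂ (x : H) (P y) := by
    have h := LinearPMap.adjoint_isFormalAdjoint hPdense
    rw [hadj] at h
    exact fun x y => h x y
  have hsymA : ∀ x y : H, inner ℂ (A x) y = inner ℂ x (A y) := hA.isSymmetric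
  refine ⟨?_, ?_⟩
  · have hP : IsClosed (P.graph : Set (H × H)) := hPsa.isClosed
    have hc : Continuous (fun p : H × H => (A p.1, p.2 + B p.1)) := by fun_prop
    have heq : ((A.compPMap P).graph : Set (H × H))
        = (fun p : H × H => (A p.1, p.2 + B p.1)) ⁻¹' (P.graph : Set (H × H)) := by
      ext ⟨x, z⟩
      simp only [Set.mem_preimage, SetLike.mem_coe, LinearPMap.mem_graph_iff]
      constructor
      · rintro ⟨f, hf, hz⟩
        have hAf := (hmem f).2 f.2
        refine ⟨⟨A f, hAf⟩, ?_, ?_⟩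
        · simp only [← hf]
        · have h1 : A (P f) = z := hz
          have h2 := hcomm f hAf
          rw [← hf, ← h1, ← h2]
          abel
      · rintro ⟨g, hg, hz⟩
        have hAx : A x ∈ P.domain := hg ▸ g.2
        have hx := (hmem x).1 hAx
        refine ⟨⟨x, hx⟩, rfl, ?_⟩
        have h2 := hcomm ⟨x, hx⟩ hAx
        have h3 : g = ⟨A x, hAx⟩ := Subtype.ext hg
        rw [h3] at hz
        change A (P ⟨x, hx⟩) = z
        simp only [hz] at h2
        have h4 : z = A (P ⟨x, hx⟩) := by
          have h5 : z - A (P ⟨x, hx⟩) = 0 := by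
            have h6 := sub_eq_zero.2 h2
            rw [← h6]; abel
          exact sub_eq_zero.1 h5
        exact h4.symm
    change IsClosed ((A.compPMap P).graph : Set (H × H))
    rw [heq]
    exact hP.preimage hc
  · set T := A.compPMap (P.compCLM A) with hT
    have hTdom : T.domain = P.domain := hdom
    have hTapp : ∀ (x : T.domain) (hx : A (x : H) ∈ P.domain), T x = A (P ⟨A x, hx⟩) :=
      fun _ _ => rfl
    have hTdense : Dense (T.domain : Set H) := by rw [hTdom]; exact hPdense
    have hformal : T.IsFormalAdjoint T := by
      intro x y
      have hx : A (x : H) ∈ P.domain := x.2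
      have hy : A (y : H) ∈ P.domain := y.2
      rw [hTapp x hx, hTapp y hy, hsymA, ← hsymA (x : H)]
      exact hsymP ⟨A x, hx⟩ ⟨A y, hy⟩
    have hle : T ≤ T.adjoint := LinearPMap.IsFormalAdjoint.le_adjoint hTdense hformal
    rw [LinearPMap.isSelfAdjoint_def]
    symm
    refine LinearPMap.eq_of_le_of_domain_eq hle (le_antisymm hle.1 ?_)
    intro y hy
    rw [hTdom, ← hmem, ← hmem, ← hadj]
    apply LinearPMap.mem_adjoint_domain_of_exists
    refine ⟨T.adjoint ⟨y, hy⟩ - B.adjoint (A y), fun f => ?_⟩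
    have hf : (f : H) ∈ T.domain := by rw [hTdom]; exact f.2
    have hAf := (hmem f).2 f.2
    have h1 : inner ℂ (T.adjoint ⟨y, hy⟩) (f : H) = inner ℂ y (T ⟨f, hf⟩) :=
      LinearPMap.adjoint_isFormalAdjoint hTdense ⟨y, hy⟩ ⟨f, hf⟩
    rw [inner_sub_left, h1, hTapp _ hAf, ContinuousLinearMap.adjoint_inner_left, ← hsymA,
      hsymA (A y), ← inner_sub_right, ← hcomm f hAf]
    congr 1
    abel
end
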